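/- Let F be an ℍ-hull with Im F < ∞ and finite half-plane capacity hcap(F) = lim_{y→∞} y E_{iy}[Im Z_{σ_F}]. Then for any η > Im F, hcap(F) = (1/π) ∫_ℝ E_{ξ+iη}[Im Z_{σ_F}] dξ. -/

import Mathlib

open MeasureTheory Filter

/-- The complex upper half-plane. -/
def UH : Set ℂ := {z | 0 < z.im}

/-- A planar Brownian motion with sample space `Ω`: a family of probability
measures `P w` (the law of Brownian motion started at `w`), with continuous
paths, Gaussian increments and independent increments. -/
structure PlanarBM (Ω : Type*) [MeasurableSpace Ω] where
  Z : ℝ → Ω → ℂ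
  P : ℂ → Measure Ω
  isProb : ∀ w, IsProbabilityMeasure (P w)
  meas : ∀ t, Measurable (Z t)
  start : ∀ w, ∀ᵐ ω ∂P w, Z 0 ω = w
  contPaths : ∀ w, ∀ᵐ ω ∂P w, Continuous fun t => Z t ω
  incrLaw : ∀ (w : ℂ) (s t : ℝ), 0 ≤ s → s ≤ t →
    (P w).map (fun ω => Z t ω - Z s ω) =
      (((ProbabilityTheory.gaussianReal 0 (Real.toNNReal (t - s))).prod
        (ProbabilityTheory.gaussianReal 0 (Real.toNNReal (t - s)))).map
        fun p : ℝ × ℝ => Complex.equivRealProd.symm p)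
  indepIncr : ∀ (w : ℂ) (s t : ℝ), 0 ≤ s → s ≤ t →
    ProbabilityTheory.IndepFun (fun ω => Z t ω - Z s ω)
      (fun ω => fun u : Set.Iic s => Z u.1 ω) (P w)

/-- First hitting time of the set `A` by the path `f` (∞ if never hit). -/
noncomputable def hitTime (f : ℝ → ℂ) (A : Set ℂ) : ENNReal :=
  sInf (ENNReal.ofReal '' {t : ℝ | 0 ≤ t ∧ f t ∈ A})

/-- First exit time of the path `f` from the set `D`. -/
noncomputable def exitTime (f : ℝ → ℂ) (D : Set ℂ) : ENNReal :=
  hitTime f Dᶜ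

/-- The path `f` exits the domain `D` (in finite time) through the set `B`. -/
def exitsInto (f : ℝ → ℂ) (D B : Set ℂ) : Prop :=
  ∃ t : ℝ, 0 ≤ t ∧ ENNReal.ofReal t = exitTime f D ∧ f t ∈ B

/-- Harmonic measure of `B` in `D` seen from `z`: the probability that Brownian
motion started at `z` exits `D` through `B`. -/
noncomputable def Hm {Ω : Type*} [MeasurableSpace Ω] (BM : PlanarBM Ω)
    (D B : Set ℂ) (z : ℂ) : ENNReal :=
  BM.P z {ω | exitsInto (fun t => BM.Z t ω) D B}

/-- `F` is an ℍ-hull: `F ⊆ ℍ`, `F` is relatively closed in ℍ, and `ℍ \ F` is a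
simply connected domain. -/
def IsHHull (F : Set ℂ) : Prop :=
  F ⊆ UH ∧ closure F ∩ UH = F ∧ SimplyConnectedSpace (UH \ F : Set ℂ)

/-- Carathéodory kernel convergence of domains with respect to the point `z₀`. -/
def KernelConvergesTo (D : ℕ → Set ℂ) (Dinf : Set ℂ) (z₀ : ℂ) : Prop :=
  (∀ K : Set ℂ, IsCompact K → K ⊆ Dinf → ∀ᶠ n in Filter.atTop, K ⊆ D n) ∧
  (∀ U : Set ℂ, IsOpen U → IsConnected U → z₀ ∈ U → {n | U ⊆ D n}.Infinite → U ⊆ Dinf)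

open scoped Classical in
/-- The imaginary part of the path `f` at the hitting time of `F`, provided `F`
is hit (in finite time) before the path leaves ℍ; zero otherwise (absorption). -/
noncomputable def imAtHit (f : ℝ → ℂ) (F : Set ℂ) : ℝ :=
  if h : ∃ t : ℝ, 0 ≤ t ∧ ENNReal.ofReal t = hitTime f F ∧ hitTime f F < exitTime f UH
  then (f h.choose).im else 0

/-- `hcap F = a`: the half-plane capacity of `F`, defined by
`hcap F = lim_{y→∞} y E_{iy}[Im Z_{σ_F}]` for absorbed Brownian motion in ℍ. -/
def HasHcap {Ω : Type*} [MeasurableSpace Ω] (BM : PlanarBM Ω) (F : Set ℂ) (a : ℝ) : Prop :=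
  Tendsto
    (fun y : ℝ => y * ∫ ω, imAtHit (fun t => BM.Z t ω) F ∂BM.P ((y : ℂ) * Complex.I))
    atTop (nhds a)

open ProbabilityTheory Topology
open scoped NNReal ENNReal

/-- Continuous paths in the plane, with the σ-algebra generated by the evaluation maps. -/
abbrev CPath := {f : ℝ≥0 → ℂ // Continuous f}

namespace CPath

lemma measurable_eval (t : ℝ≥0) : Measurable fun p : CPath => p.1 t :=
  (measurable_pi_apply t).comp measurable_subtype_coe

lemma measurable_eval_prod : Measurable fun q : ℝ≥0 × CPath => q.2.1 q.1 :=
  measurable_uncurry_of_continuous_of_measurable (u := fun (t : ℝ≥0) (p : CPath) => p.1 t)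
    (fun p => p.2) measurable_eval

lemma measurable_eval_comp {α : Type*} [MeasurableSpace α] {τ : α → ℝ≥0} {p : α → CPath}
    (hτ : Measurable τ) (hp : Measurable p) : Measurable fun a => (p a).1 (τ a) :=
  measurable_eval_prod.comp (hτ.prodMk hp)

lemma measurable_of_eval {α : Type*} [MeasurableSpace α] {p : α → CPath}
    (h : ∀ t, Measurable fun a => (p a).1 t) : Measurable p :=
  Measurable.subtype_mk (measurable_pi_lambda _ h)

/-- The increments of a path after time `t`. -/
def shift (t : ℝ≥0) (p : CPath) : CPath :=
  ⟨fun s => p.1 (t + s) - p.1 t, by have := p.2; fun_prop⟩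

/-- The path stopped at time `t`. -/
def freeze (t : ℝ≥0) (p : CPath) : CPath :=
  ⟨fun s => p.1 (min s t), by have := p.2; fun_prop⟩

/-- The path translated by `z`. -/
def translate (z : ℂ) (p : CPath) : CPath :=
  ⟨fun s => z + p.1 s, by have := p.2; fun_prop⟩

lemma measurable_shift {τ : CPath → ℝ≥0} (hτ : Measurable τ) :
    Measurable fun p => shift (τ p) p :=
  measurable_of_eval fun t =>
    (measurable_eval_comp (hτ.add_const t) measurable_id).sub
      (measurable_eval_comp hτ measurable_id)

lemma measurable_translate : Measurable fun q : ℂ × CPath => translate q.1 q.2 :=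
  measurable_of_eval fun t => measurable_fst.add ((measurable_eval t).comp measurable_snd)

/-- Finite measures on path space are determined by their finite-dimensional marginals. -/
lemma ext_of_forall_integral_restrict {μ ν : Measure CPath} [IsFiniteMeasure μ]
    [IsFiniteMeasure ν]
    (h : ∀ (I : Finset ℝ≥0) (g : BoundedContinuousFunction (I → ℂ) ℝ),
      ∫ p, g (I.restrict p.1) ∂μ = ∫ p, g (I.restrict p.1) ∂ν) : μ = ν := by
  have hm : ∀ I : Finset ℝ≥0, Measurable fun p : CPath => I.restrict p.1 := fun I =>
    (Finset.measurable_restrict I).comp measurable_subtype_coe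
  have key : ∀ I : Finset ℝ≥0, μ.map (fun p => I.restrict p.1) = ν.map fun p => I.restrict p.1 := by
    intro I
    refine ext_of_forall_integral_eq_of_IsFiniteMeasure fun g => ?_
    rw [integral_map (hm I).aemeasurable g.continuous.aestronglyMeasurable,
      integral_map (hm I).aemeasurable g.continuous.aestronglyMeasurable, h]
  have hval : μ.map (Subtype.val : CPath → ℝ≥0 → ℂ) = ν.map Subtype.val := by
    have h1 := isProjectiveLimit_map (P := μ) (X := fun t p => p.1 t)
      (measurable_subtype_coe.aemeasurable)
    have h2 := isProjectiveLimit_map (P := ν) (X := fun t p => p.1 t)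
      (measurable_subtype_coe.aemeasurable)
    have e : (fun I : Finset ℝ≥0 => μ.map fun p : CPath => I.restrict fun t => p.1 t) =
        fun I : Finset ℝ≥0 => ν.map fun p : CPath => I.restrict fun t => p.1 t :=
      funext fun I => key I
    rw [e] at h1
    exact h1.unique h2
  ext s hs
  obtain ⟨B, hB, rfl⟩ := hs
  rw [← Measure.map_apply measurable_subtype_coe hB, hval,
    Measure.map_apply measurable_subtype_coe hB]

end CPath

/-- The law of a planar Gaussian vector with independent centred components of variance `v`. -/
noncomputable def planarGaussian (v : ℝ≥0) : Measure ℂ :=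
  ((gaussianReal 0 v).prod (gaussianReal 0 v)).map
    fun p : ℝ × ℝ => Complex.equivRealProd.symm p

lemma measurable_equivRealProd_symm :
    Measurable fun p : ℝ × ℝ => Complex.equivRealProd.symm p :=
  Complex.measurableEquivRealProd.symm.measurable

instance (v : ℝ≥0) : IsProbabilityMeasure (planarGaussian v) :=
  Measure.isProbabilityMeasure_map measurable_equivRealProd_symm.aemeasurable

/-- Membership in `A` depends only on the path up to time `t`. -/
def DeterminedUpTo (t : ℝ≥0) (A : Set CPath) : Prop :=
  ∀ f g : CPath, (∀ s ≤ t, f.1 s = g.1 s) → f ∈ A → g ∈ A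

/-- `μ` is the law of planar Brownian motion started at the origin. -/
structure IsWiener (μ : Measure CPath) : Prop where
  prob : IsProbabilityMeasure μ
  zero : ∀ᵐ p ∂μ, p.1 0 = 0
  incr : ∀ s t : ℝ≥0, s ≤ t → ∀ A : Set CPath, MeasurableSet A → DeterminedUpTo s A →
    ∀ B : Set ℂ, MeasurableSet B →
      μ (A ∩ {p | p.1 t - p.1 s ∈ B}) = μ A * planarGaussian (t - s) B

namespace CPath

/-- The increments of a path along the grid of mesh `1 / (n + 1)` starting at `t`. -/
noncomputable def gridIncr (n : ℕ) (t : ℝ≥0) (p : CPath) (j : ℕ) : ℂ :=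
  p.1 (t + (j + 1) / (n + 1)) - p.1 (t + j / (n + 1))

lemma measurable_gridIncr (n : ℕ) {τ : CPath → ℝ≥0} (hτ : Measurable τ) :
    Measurable fun p => gridIncr n (τ p) p :=
  measurable_pi_lambda _ fun _ =>
    (measurable_eval_comp (hτ.add_const _) measurable_id).sub
      (measurable_eval_comp (hτ.add_const _) measurable_id)

lemma sum_gridIncr (n : ℕ) (t : ℝ≥0) (p : CPath) (m : ℕ) :
    ∑ j ∈ Finset.range m, gridIncr n t p j = p.1 (t + m / (n + 1)) - p.1 t := by
  have := Finset.sum_range_sub (fun j : ℕ => p.1 (t + j / (n + 1))) m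
  simpa [gridIncr] using this

end CPath

open CPath

lemma IsWiener.measure_inter_gridIncr {μ : Measure CPath} (hμ : IsWiener μ) (n : ℕ) (t : ℝ≥0)
    {A : Set CPath} (hA : MeasurableSet A) (hdet : DeterminedUpTo t A) (B : ℕ → Set ℂ)
    (hB : ∀ i, MeasurableSet (B i)) (s : Finset ℕ) :
    μ (A ∩ gridIncr n t ⁻¹' (Set.pi s B)) =
      μ A * ∏ i ∈ s, planarGaussian (1 / (n + 1)) (B i) := by
  induction s using Finset.induction_on_max with
  | empty => simp
  | insert a s hs ih =>
    have hset : A ∩ gridIncr n t ⁻¹' (Set.pi ↑(insert a s) B) =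
        (A ∩ gridIncr n t ⁻¹' (Set.pi s B)) ∩
          {p | p.1 (t + (a + 1) / (n + 1)) - p.1 (t + a / (n + 1)) ∈ B a} := by
      ext p
      simp only [Finset.coe_insert, Set.insert_pi, Set.preimage_inter, Set.mem_inter_iff,
        Set.mem_preimage, Function.eval, gridIncr, Set.mem_ofPred_eq]
      tauto
    rw [hset, hμ.incr _ _ (by gcongr; simp) _ (hA.inter (measurable_gridIncr n measurable_const
      (MeasurableSet.pi (Finset.countable_toSet _) fun i _ => hB i))) ?_ _ (hB a), ih,
      Finset.prod_insert (fun h => (hs a h).false)]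
    · rw [add_tsub_add_eq_tsub_left, ← NNReal.sub_div, add_tsub_cancel_left]
      ring
    · rintro f g hfg ⟨h1, h2⟩
      refine ⟨hdet f g (fun u hu => hfg u (hu.trans le_self_add)) h1, fun i hi => ?_⟩
      have hia : i + 1 ≤ a := hs i hi
      have h3 := h2 i hi
      simp only [gridIncr] at h3 ⊢
      rwa [← hfg _ (by gcongr; exact_mod_cast hia),
        ← hfg _ (by gcongr; exact (Nat.le_succ i).trans hia)]

/-- `τ` is a stopping time. -/
def IsStopTime (τ : CPath → ℝ≥0) : Prop :=
  ∀ f g : CPath, (∀ s ≤ τ f, f.1 s = g.1 s) → τ g = τ f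

/-- `A` is an event of the past of `τ`. -/
def PastOf (τ : CPath → ℝ≥0) (A : Set CPath) : Prop :=
  ∀ f g : CPath, (∀ s ≤ τ f, f.1 s = g.1 s) → f ∈ A → g ∈ A

/-- The discretization from above of a random time. -/
noncomputable def gridTime (n : ℕ) (t : ℝ≥0) : ℝ≥0 := (⌊t * (n + 1)⌋₊ + 1) / (n + 1)

lemma measurable_gridTime (n : ℕ) : Measurable (gridTime n) := by
  unfold gridTime
  exact ((measurable_from_nat (f := fun k : ℕ => (k : ℝ≥0))).comp
    (Nat.measurable_floor.comp (measurable_id.mul_const _))).add_const _ |>.div_const _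

lemma le_gridTime (n : ℕ) (t : ℝ≥0) : t ≤ gridTime n t := by
  rw [gridTime, le_div_iff₀ (by positivity)]
  exact (Nat.lt_floor_add_one _).le

lemma IsWiener.measure_inter_gridIncr_gridTime {μ : Measure CPath} (hμ : IsWiener μ) (n : ℕ)
    {τ : CPath → ℝ≥0} (hτ : Measurable τ) (hst : IsStopTime τ)
    {A : Set CPath} (hA : MeasurableSet A) (hpast : PastOf τ A) (B : ℕ → Set ℂ)
    (hB : ∀ i, MeasurableSet (B i)) (s : Finset ℕ) :
    μ (A ∩ (fun p => gridIncr n (gridTime n (τ p)) p) ⁻¹' (Set.pi s B)) =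
      μ A * ∏ i ∈ s, planarGaussian (1 / (n + 1)) (B i) := by
  let Ak : ℕ → Set CPath := fun k => A ∩ {p | ⌊τ p * (n + 1)⌋₊ = k}
  have hAk : ∀ k, MeasurableSet (Ak k) := fun k =>
    hA.inter ((Nat.measurable_floor.comp (hτ.mul_const _)) (measurableSet_singleton k))
  have hdet : ∀ k : ℕ, DeterminedUpTo ((k + 1) / (n + 1)) (Ak k) := by
    rintro k f g hfg ⟨h1, h2⟩
    have hle : τ f ≤ (k + 1) / (n + 1) := by
      have := le_gridTime n (τ f)
      rwa [gridTime, h2] at this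
    have hfg' : ∀ s ≤ τ f, f.1 s = g.1 s := fun u hu => hfg u (hu.trans hle)
    refine ⟨hpast f g hfg' h1, ?_⟩
    simp only [Set.mem_ofPred_eq] at h2 ⊢
    rw [hst f g hfg', h2]
  have hpi : MeasurableSet (Set.pi (s : Set ℕ) B) :=
    MeasurableSet.pi (Finset.countable_toSet _) fun i _ => hB i
  have hdisj : Pairwise (Function.onFun Disjoint Ak) := by
    intro i j hij
    rw [Function.onFun, Set.disjoint_left]
    rintro p ⟨-, h1⟩ ⟨-, h2⟩
    exact hij (h1.symm.trans h2)
  have hset : A ∩ (fun p => gridIncr n (gridTime n (τ p)) p) ⁻¹' (Set.pi s B) =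
      ⋃ k, Ak k ∩ gridIncr n ((k + 1) / (n + 1)) ⁻¹' (Set.pi s B) := by
    ext p
    simp only [Set.mem_iUnion, Ak, Set.mem_inter_iff, Set.mem_ofPred_eq, Set.mem_preimage]
    constructor
    · rintro ⟨h1, h2⟩
      exact ⟨_, ⟨h1, rfl⟩, h2⟩
    · rintro ⟨k, ⟨h1, rfl⟩, h2⟩
      exact ⟨h1, h2⟩
  have hunion : A = ⋃ k, Ak k := by ext p; simp [Ak]
  rw [hset, measure_iUnion (fun i j hij => (hdisj hij).mono Set.inter_subset_left
    Set.inter_subset_left) fun k => (hAk k).inter (measurable_gridIncr n measurable_const hpi)]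
  rw [tsum_congr fun k => hμ.measure_inter_gridIncr n _ (hAk k) (hdet k) B hB s,
    ENNReal.tsum_mul_right, ← measure_iUnion hdisj hAk, ← hunion]

lemma map_restrict_eq_smul_infinitePi {Ω : Type*} [MeasurableSpace Ω] {μ : Measure Ω}
    [IsFiniteMeasure μ] {A : Set Ω} {Y : Ω → ℕ → ℂ} (hY : Measurable Y)
    (G : Measure ℂ) [IsProbabilityMeasure G]
    (h : ∀ (s : Finset ℕ) (B : ℕ → Set ℂ), (∀ i, MeasurableSet (B i)) →
      μ (A ∩ Y ⁻¹' (Set.pi s B)) = μ A * ∏ i ∈ s, G (B i)) :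
    (μ.restrict A).map Y = μ A • Measure.infinitePi fun _ => G := by
  by_cases h0 : μ A = 0
  · simp [h0, Measure.restrict_eq_zero.2 h0]
  have hne : μ A ≠ ∞ := measure_ne_top _ _
  have : (μ A)⁻¹ • (μ.restrict A).map Y = Measure.infinitePi fun _ => G := by
    refine Measure.eq_infinitePi _ fun s B hB => ?_
    have hpi : MeasurableSet (Set.pi (s : Set ℕ) B) :=
      MeasurableSet.pi (Finset.countable_toSet _) fun i _ => hB i
    rw [Measure.smul_apply, Measure.map_apply hY hpi, Measure.restrict_apply (hY hpi),
      Set.inter_comm, h s B hB, smul_eq_mul, ← mul_assoc, ENNReal.inv_mul_cancel h0 hne, one_mul]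
  rw [← this, smul_smul, ENNReal.mul_inv_cancel h0 hne, one_smul]

lemma gridTime_le (n : ℕ) (t : ℝ≥0) : gridTime n t ≤ t + 1 / (n + 1) := by
  rw [gridTime, add_div]
  gcongr
  rw [div_le_iff₀ (by positivity)]
  exact Nat.floor_le zero_le

lemma tendsto_gridTime (t : ℝ≥0) : Tendsto (fun n => gridTime n t) atTop (𝓝 t) := by
  refine tendsto_of_tendsto_of_tendsto_of_le_of_le tendsto_const_nhds (?_ : Tendsto
    (fun n : ℕ => t + 1 / ((n : ℝ≥0) + 1)) atTop (𝓝 t)) (fun n => le_gridTime n t)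
    fun n => gridTime_le n t
  simpa using tendsto_const_nhds.add (tendsto_one_div_add_atTop_nhds_zero_nat (𝕜 := ℝ≥0))

lemma tendsto_floor_mul_div (t : ℝ≥0) :
    Tendsto (fun n : ℕ => (⌊t * (n + 1)⌋₊ : ℝ≥0) / (n + 1)) atTop (𝓝 t) := by
  have h : ∀ n : ℕ, (⌊t * (n + 1)⌋₊ : ℝ≥0) / (n + 1) = gridTime n t - 1 / (n + 1) := by
    intro n
    rw [gridTime, add_div, add_tsub_cancel_right]
  simp_rw [h]
  simpa using (tendsto_gridTime t).sub (tendsto_one_div_add_atTop_nhds_zero_nat (𝕜 := ℝ≥0))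

/-- The values at the times in `I` of the path interpolating the sums of `x` along the grid of
mesh `1 / (n + 1)`. -/
noncomputable def gridSum (n : ℕ) (I : Finset ℝ≥0) (x : ℕ → ℂ) (i : I) : ℂ :=
  ∑ j ∈ Finset.range ⌊(i : ℝ≥0) * (n + 1)⌋₊, x j

lemma measurable_gridSum (n : ℕ) (I : Finset ℝ≥0) : Measurable (gridSum n I) :=
  measurable_pi_lambda _ fun _ => Finset.measurable_sum _ fun j _ => measurable_pi_apply j

lemma tendsto_gridSum (I : Finset ℝ≥0) (t : ℝ≥0) (p : CPath) :
    Tendsto (fun n => gridSum n I (gridIncr n (gridTime n t) p)) atTop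
      (𝓝 (I.restrict (shift t p).1)) := by
  rw [tendsto_pi_nhds]
  intro i
  simp only [gridSum, sum_gridIncr]
  exact ((p.2.tendsto _).comp ((tendsto_gridTime t).add (tendsto_floor_mul_div i))).sub
    ((p.2.tendsto _).comp (tendsto_gridTime t))

lemma IsWiener.tendsto_setIntegral_shift {μ : Measure CPath} (hμ : IsWiener μ)
    {τ : CPath → ℝ≥0} (hτ : Measurable τ) (hst : IsStopTime τ) {A : Set CPath}
    (hA : MeasurableSet A) (hpast : PastOf τ A) (I : Finset ℝ≥0)
    (g : BoundedContinuousFunction (I → ℂ) ℝ) :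
    Tendsto (fun n : ℕ => μ.real A * ∫ x, g (gridSum n I x)
        ∂Measure.infinitePi fun _ : ℕ => planarGaussian (1 / (n + 1))) atTop
      (𝓝 (∫ p in A, g (I.restrict (shift (τ p) p).1) ∂μ)) := by
  have := hμ.prob
  have hY : ∀ n, Measurable fun p => gridIncr n (gridTime n (τ p)) p := fun n =>
    measurable_gridIncr n ((measurable_gridTime n).comp hτ)
  have heq : ∀ n : ℕ, μ.real A * ∫ x, g (gridSum n I x)
        ∂Measure.infinitePi (fun _ : ℕ => planarGaussian (1 / (n + 1))) =
      ∫ p in A, g (gridSum n I (gridIncr n (gridTime n (τ p)) p)) ∂μ := by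
    intro n
    have hmap := map_restrict_eq_smul_infinitePi (μ := μ) (A := A) (hY n) _
      fun s B hB => hμ.measure_inter_gridIncr_gridTime n hτ hst hA hpast B hB s
    rw [← integral_map (f := fun x => g (gridSum n I x)) (hY n).aemeasurable
      (g.continuous.measurable.comp (measurable_gridSum n I)).aestronglyMeasurable, hmap,
      integral_smul_measure, smul_eq_mul, Measure.real]
  simp_rw [heq]
  refine tendsto_integral_of_dominated_convergence (fun _ => ‖g‖) (fun n => ?_)
    (integrable_const _) (fun n => ae_of_all _ fun p => g.norm_coe_le_norm _)
    (ae_of_all _ fun p => (g.continuous.tendsto _).comp (tendsto_gridSum I (τ p) p))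
  exact (g.continuous.measurable.comp
    ((measurable_gridSum n I).comp (hY n))).aestronglyMeasurable

/-- The strong Markov property of planar Brownian motion. -/
theorem IsWiener.strongMarkov {μ ν : Measure CPath} (hμ : IsWiener μ) (hν : IsWiener ν)
    {τ : CPath → ℝ≥0} (hτ : Measurable τ) (hst : IsStopTime τ) {A : Set CPath}
    (hA : MeasurableSet A) (hpast : PastOf τ A) :
    (μ.restrict A).map (fun p => shift (τ p) p) = μ A • ν := by
  have := hμ.prob
  have := hν.prob
  have hs := measurable_shift hτ
  have : IsFiniteMeasure (μ A • ν) := Measure.smul_finite ν (measure_ne_top μ A)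
  refine ext_of_forall_integral_restrict fun I g => ?_
  have hg : Measurable fun p : CPath => g (I.restrict p.1) :=
    g.continuous.measurable.comp ((Finset.measurable_restrict I).comp measurable_subtype_coe)
  have h1 := hμ.tendsto_setIntegral_shift hτ hst hA hpast I g
  have h2 := (hν.tendsto_setIntegral_shift (τ := fun _ => 0) measurable_const (fun _ _ _ => rfl)
    (A := Set.univ) MeasurableSet.univ (fun _ _ _ _ => trivial) I g)
  simp only [probReal_univ, one_mul, Measure.restrict_univ] at h2
  have h3 := tendsto_nhds_unique h1 (h2.const_mul (μ.real A))
  rw [integral_map hs.aemeasurable hg.aestronglyMeasurable, h3, integral_smul_measure,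
    smul_eq_mul, Measure.real]
  congr 1
  refine integral_congr_ae ?_
  filter_upwards [hν.zero] with p hp
  simp [shift, hp]

lemma IsWiener.unique {μ ν : Measure CPath} (hμ : IsWiener μ) (hν : IsWiener ν) : μ = ν := by
  have := hμ.prob
  have h := hμ.strongMarkov hν (τ := fun _ => 0) measurable_const (fun _ _ _ => rfl)
    MeasurableSet.univ (fun _ _ _ _ => trivial)
  rw [measure_univ, one_smul, Measure.restrict_univ] at h
  rw [← h]
  conv_lhs => rw [← Measure.map_id (μ := μ)]
  refine Measure.map_congr ?_
  filter_upwards [hμ.zero] with p hp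
  refine Subtype.ext (funext fun t => ?_)
  simp [shift, hp]

/-- At a stopping time the future increments are independent of the past. -/
lemma IsWiener.map_prodMk_shift {μ : Measure CPath} (hμ : IsWiener μ) {τ : CPath → ℝ≥0}
    (hτ : Measurable τ) (hst : IsStopTime τ) {β : Type*} [MeasurableSpace β] {X : CPath → β}
    (hX : Measurable X)
    (hpast : ∀ f g : CPath, (∀ s ≤ τ f, f.1 s = g.1 s) → X g = X f) :
    μ.map (fun p => (X p, shift (τ p) p)) = (μ.map X).prod μ := by
  have := hμ.prob
  have := Measure.isProbabilityMeasure_map (μ := μ) hX.aemeasurable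
  have hs := measurable_shift hτ
  refine (Measure.prod_eq fun s t hs' ht => ?_).symm
  have h := hμ.strongMarkov hμ hτ hst (A := X ⁻¹' s) (hX hs') fun f g hfg hf => by
    simpa [hpast f g hfg] using hf
  have h' := congrArg (fun m => m t) h
  simp only [Measure.map_apply hs ht, Measure.restrict_apply (hs ht), Measure.smul_apply,
    smul_eq_mul] at h'
  rw [Measure.map_apply (hX.prodMk hs) (hs'.prod ht), Measure.map_apply hX hs', ← h']
  congr 1
  ext p
  simp [and_comm]

namespace PlanarBM

variable {Ω : Type*} [MeasurableSpace Ω] (BM : PlanarBM Ω)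

/-- A measurable event of full probability on which the paths are continuous. -/
def continuitySet (w : ℂ) : Set Ω :=
  (toMeasurable (BM.P w) {ω | ¬ Continuous fun t => BM.Z t ω})ᶜ

lemma measurableSet_continuitySet (w : ℂ) : MeasurableSet (BM.continuitySet w) :=
  (measurableSet_toMeasurable _ _).compl

lemma ae_mem_continuitySet (w : ℂ) : ∀ᵐ ω ∂BM.P w, ω ∈ BM.continuitySet w := by
  rw [ae_iff]
  have : {ω | ω ∉ BM.continuitySet w} =
      toMeasurable (BM.P w) {ω | ¬ Continuous fun t => BM.Z t ω} := by
    ext ω; simp [continuitySet]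
  rw [this, measure_toMeasurable]
  exact ae_iff.1 (BM.contPaths w)

lemma continuous_of_mem_continuitySet {w : ℂ} {ω : Ω} (h : ω ∈ BM.continuitySet w) :
    Continuous fun t => BM.Z t ω := by
  by_contra hc
  exact h (subset_toMeasurable _ _ hc)

open scoped Classical in
/-- The Brownian path started at `w`, recentred at the origin. -/
noncomputable def path (w : ℂ) (ω : Ω) : CPath :=
  if h : ω ∈ BM.continuitySet w then
    ⟨fun t => BM.Z t ω - w,
      ((BM.continuous_of_mem_continuitySet h).comp NNReal.continuous_coe).sub continuous_const⟩
  else ⟨fun _ => 0, continuous_const⟩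

lemma path_apply {w : ℂ} {ω : Ω} (h : ω ∈ BM.continuitySet w) (t : ℝ≥0) :
    (BM.path w ω).1 t = BM.Z t ω - w := by
  simp [path, h]

lemma measurable_path (w : ℂ) : Measurable (BM.path w) := by
  classical
  refine measurable_of_eval fun t => ?_
  have : (fun ω => (BM.path w ω).1 t) =
      fun ω => if ω ∈ BM.continuitySet w then BM.Z t ω - w else 0 := by
    ext ω
    by_cases h : ω ∈ BM.continuitySet w <;> simp [path, h]
  rw [this]
  exact Measurable.ite (BM.measurableSet_continuitySet w) ((BM.meas t).sub_const w)
    measurable_const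

lemma isWiener_map_path (w : ℂ) : IsWiener ((BM.P w).map (BM.path w)) where
  prob := by
    have := BM.isProb w
    exact Measure.isProbabilityMeasure_map (BM.measurable_path w).aemeasurable
  zero := by
    have hm : MeasurableSet {p : CPath | p.1 0 = 0} :=
      measurable_eval 0 (measurableSet_singleton 0)
    rw [ae_map_iff (BM.measurable_path w).aemeasurable hm]
    filter_upwards [BM.ae_mem_continuitySet w, BM.start w] with ω h1 h2
    rw [BM.path_apply h1, NNReal.coe_zero, h2, sub_self]
  incr := by
    intro s t hst A hA hdet B hB
    have hinc : MeasurableSet {p : CPath | p.1 t - p.1 s ∈ B} :=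
      ((measurable_eval t).sub (measurable_eval s)) hB
    rw [Measure.map_apply (BM.measurable_path w) (hA.inter hinc),
      Measure.map_apply (BM.measurable_path w) hA]
    obtain ⟨A₀, hA₀, rfl⟩ := hA
    let r : (Set.Iic (s : ℝ) → ℂ) → ℝ≥0 → ℂ := fun x u =>
      x ⟨(min u s : ℝ≥0), by simp⟩ - w
    have hr : Measurable r :=
      measurable_pi_lambda _ fun u => by
        have h : Measurable fun x : Set.Iic (s : ℝ) → ℂ => x ⟨(min u s : ℝ≥0), by simp⟩ :=
          measurable_pi_apply _
        exact h.sub_const w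
    have hfreeze : ∀ p : CPath, p.1 ∈ A₀ ↔ (freeze s p).1 ∈ A₀ := by
      intro p
      exact ⟨hdet p (freeze s p) fun u hu => by simp [freeze, hu],
        hdet (freeze s p) p fun u hu => by simp [freeze, hu]⟩
    have hpast : ∀ᵐ ω ∂BM.P w, (BM.path w ω ∈ (Subtype.val ⁻¹' A₀ : Set CPath) ↔
        (fun u : Set.Iic (s : ℝ) => BM.Z u.1 ω) ∈ r ⁻¹' A₀) := by
      filter_upwards [BM.ae_mem_continuitySet w] with ω hω
      rw [Set.mem_preimage, hfreeze, Set.mem_preimage]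
      have : (freeze s (BM.path w ω)).1 = r fun u : Set.Iic (s : ℝ) => BM.Z u.1 ω := by
        ext u
        simp only [freeze, r, BM.path_apply hω]
      rw [this]
    have hind := BM.indepIncr w s t s.2 (by exact_mod_cast hst)
    have hlaw := BM.incrLaw w s t s.2 (by exact_mod_cast hst)
    have hv : Real.toNNReal ((t : ℝ) - s) = t - s := by
      rw [← NNReal.coe_sub hst, Real.toNNReal_coe]
    rw [hv] at hlaw
    have h1 := hind.symm.measure_inter_preimage_eq_mul (r ⁻¹' A₀) B (hr hA₀) hB
    have h2 : BM.P w ((fun ω => BM.Z t ω - BM.Z s ω) ⁻¹' B) = planarGaussian (t - s) B := by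
      have hm : Measurable fun ω => BM.Z t ω - BM.Z s ω := (BM.meas t).sub (BM.meas s)
      rw [← Measure.map_apply hm hB, hlaw]
      rfl
    rw [h2] at h1
    have e1 : BM.P w (BM.path w ⁻¹' (Subtype.val ⁻¹' A₀)) =
        BM.P w ((fun ω => fun u : Set.Iic (s : ℝ) => BM.Z u.1 ω) ⁻¹' (r ⁻¹' A₀)) := by
      refine measure_congr ?_
      filter_upwards [hpast] with ω hω
      exact propext hω
    rw [e1, ← h1]
    refine measure_congr ?_
    filter_upwards [hpast, BM.ae_mem_continuitySet w] with ω hω hc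
    refine propext (and_congr hω ?_)
    simp [BM.path_apply hc]

end PlanarBM

namespace CPath

variable {D : Set ℂ}

lemma measurableSet_exists_le_mem (hD : IsClosed D) (t : ℝ≥0) :
    MeasurableSet {p : CPath | ∃ s ≤ t, p.1 s ∈ D} := by
  have : {p : CPath | ∃ s ≤ t, p.1 s ∈ D} = ⋂ n : ℕ, ⋃ k : ℕ, {p : CPath |
      Metric.infEDist (p.1 (min (TopologicalSpace.denseSeq ℝ≥0 k) t)) D < (n : ℝ≥0∞)⁻¹} := by
    ext p
    simp only [Set.mem_ofPred_eq, Set.mem_iInter, Set.mem_iUnion]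
    have hp := p.2
    have hc : Continuous fun u => Metric.infEDist (p.1 u) D :=
      Metric.continuous_infEDist.comp hp
    constructor
    · rintro ⟨s, hs, hsD⟩ n
      have ho : IsOpen {u : ℝ≥0 | Metric.infEDist (p.1 (min u t)) D < (n : ℝ≥0∞)⁻¹} :=
        isOpen_Iio.preimage (hc.comp (continuous_id.min continuous_const))
      exact (TopologicalSpace.denseRange_denseSeq ℝ≥0).exists_mem_open ho
        ⟨s, by simp [min_eq_left hs, Metric.infEDist_zero_of_mem hsD]⟩
    · intro h
      obtain ⟨s, hs, hmin⟩ := (isCompact_Icc (a := (0 : ℝ≥0)) (b := t)).exists_isMinOn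
        ⟨0, by simp⟩ hc.continuousOn
      refine ⟨s, hs.2, ?_⟩
      rw [Metric.mem_iff_infEDist_zero_of_closed hD]
      by_contra hne
      obtain ⟨n, hn⟩ := ENNReal.exists_inv_nat_lt hne
      obtain ⟨k, hk⟩ := h n
      exact absurd (hk.trans hn) (not_lt.2 (hmin ⟨zero_le, min_le_right _ _⟩))
  rw [this]
  refine MeasurableSet.iInter fun n => MeasurableSet.iUnion fun k => ?_
  exact (Metric.continuous_infEDist.measurable.comp (measurable_eval _)) measurableSet_Iio

lemma measurableSet_exists_mem (hD : IsClosed D) :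
    MeasurableSet {p : CPath | ∃ s, p.1 s ∈ D} := by
  have : {p : CPath | ∃ s, p.1 s ∈ D} = ⋃ n : ℕ, {p : CPath | ∃ s ≤ (n : ℝ≥0), p.1 s ∈ D} := by
    ext p
    simp only [Set.mem_ofPred_eq, Set.mem_iUnion]
    constructor
    · rintro ⟨s, hs⟩
      obtain ⟨n, hn⟩ := exists_nat_ge s
      exact ⟨n, s, hn, hs⟩
    · rintro ⟨n, s, -, hs⟩
      exact ⟨s, hs⟩
  rw [this]
  exact MeasurableSet.iUnion fun n => measurableSet_exists_le_mem hD n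

/-- The first hitting time of `D`, truncated at `N`. -/
noncomputable def firstHit (D : Set ℂ) (N : ℝ≥0) (p : CPath) : ℝ≥0 :=
  sInf (insert N {t | p.1 t ∈ D})

lemma firstHit_le (D : Set ℂ) (N : ℝ≥0) (p : CPath) : firstHit D N p ≤ N :=
  csInf_le (OrderBot.bddBelow _) (Set.mem_insert _ _)

lemma firstHit_le_of_mem {N t : ℝ≥0} {p : CPath} (h : p.1 t ∈ D) : firstHit D N p ≤ t :=
  csInf_le (OrderBot.bddBelow _) (Set.mem_insert_of_mem _ h)

lemma firstHit_eq_or_mem (hD : IsClosed D) (N : ℝ≥0) (p : CPath) :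
    firstHit D N p = N ∨ p.1 (firstHit D N p) ∈ D := by
  have hc : IsClosed (insert N {t | p.1 t ∈ D}) :=
    isClosed_singleton.union (hD.preimage p.2)
  exact hc.csInf_mem (Set.insert_nonempty _ _) (OrderBot.bddBelow _)

lemma firstHit_le_iff (hD : IsClosed D) (N t : ℝ≥0) (p : CPath) :
    firstHit D N p ≤ t ↔ N ≤ t ∨ ∃ s ≤ t, p.1 s ∈ D := by
  constructor
  · intro h
    rcases firstHit_eq_or_mem hD N p with h' | h'
    · exact Or.inl (h' ▸ h)
    · exact Or.inr ⟨_, h, h'⟩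
  · rintro (h | ⟨s, hs, h⟩)
    · exact (firstHit_le D N p).trans h
    · exact (firstHit_le_of_mem h).trans hs

lemma measurable_firstHit (hD : IsClosed D) (N : ℝ≥0) : Measurable (firstHit D N) := by
  refine measurable_of_Iic fun t => ?_
  have : firstHit D N ⁻¹' Set.Iic t = {_p : CPath | N ≤ t} ∪ {p | ∃ s ≤ t, p.1 s ∈ D} := by
    ext p
    exact firstHit_le_iff hD N t p
  rw [this]
  exact (MeasurableSet.const _).union (measurableSet_exists_le_mem hD t)

lemma isStopTime_firstHit (hD : IsClosed D) (N : ℝ≥0) : IsStopTime (firstHit D N) := by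
  intro f g hfg
  refine le_antisymm ?_ ?_
  · rcases firstHit_eq_or_mem hD N f with h | h
    · exact (firstHit_le D N g).trans_eq h.symm
    · exact firstHit_le_of_mem (hfg _ le_rfl ▸ h)
  · rcases firstHit_eq_or_mem hD N g with h | h
    · exact (firstHit_le D N f).trans_eq h.symm
    · by_contra! hlt
      rw [← hfg _ hlt.le] at h
      exact absurd hlt (not_lt.2 (firstHit_le_of_mem h))

lemma eval_firstHit_congr (hD : IsClosed D) (N : ℝ≥0) {f g : CPath}
    (hfg : ∀ s ≤ firstHit D N f, f.1 s = g.1 s) :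
    g.1 (firstHit D N g) = f.1 (firstHit D N f) := by
  rw [isStopTime_firstHit hD N f g hfg, hfg _ le_rfl]

lemma measurable_eval_firstHit (hD : IsClosed D) (N : ℝ≥0) :
    Measurable fun p : CPath => p.1 (firstHit D N p) :=
  measurable_eval_comp (measurable_firstHit hD N) measurable_id

lemma exists_isLeast_hit (hD : IsClosed D) {p : CPath} (h : ∃ t, p.1 t ∈ D) :
    ∃ t, IsLeast {t | p.1 t ∈ D} t := by
  have hc : IsClosed {t | p.1 t ∈ D} := hD.preimage p.2
  exact ⟨_, hc.csInf_mem h (OrderBot.bddBelow _), fun t ht => csInf_le (OrderBot.bddBelow _) ht⟩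

lemma firstHit_of_isLeast {p : CPath} {t N : ℝ≥0} (ht : IsLeast {t | p.1 t ∈ D} t)
    (hN : t ≤ N) : firstHit D N p = t :=
  IsLeast.csInf_eq ⟨Set.mem_insert_of_mem _ ht.1, by
    rintro s (rfl | hs)
    · exact hN
    · exact ht.2 hs⟩

open scoped Classical in
/-- The point where the path first hits `D`; zero if `D` is never hit. -/
noncomputable def hitPt (D : Set ℂ) (p : CPath) : ℂ :=
  if ∃ t, p.1 t ∈ D then p.1 (sInf {t | p.1 t ∈ D}) else 0

lemma hitPt_of_isLeast {p : CPath} {t : ℝ≥0} (ht : IsLeast {t | p.1 t ∈ D} t) :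
    hitPt D p = p.1 t := by
  rw [hitPt, if_pos ⟨t, ht.1⟩, ht.csInf_eq]

lemma hitPt_of_forall_notMem {p : CPath} (h : ∀ t, p.1 t ∉ D) : hitPt D p = 0 := by
  rw [hitPt, if_neg (by simpa using h)]

lemma eventually_eval_firstHit_eq (hD : IsClosed D) {p : CPath} (hp : ∃ t, p.1 t ∈ D) :
    ∀ᶠ n : ℕ in atTop, p.1 (firstHit D n p) = hitPt D p := by
  obtain ⟨t, ht⟩ := exists_isLeast_hit hD hp
  obtain ⟨n, hn⟩ := exists_nat_ge t
  filter_upwards [eventually_ge_atTop n] with m hm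
  rw [hitPt_of_isLeast ht, firstHit_of_isLeast ht (hn.trans (by exact_mod_cast hm))]

lemma measurable_hitPt (hD : IsClosed D) : Measurable (hitPt D) := by
  classical
  have hm : ∀ n : ℕ, Measurable fun p : CPath =>
      if ∃ s, p.1 s ∈ D then p.1 (firstHit D n p) else 0 := fun n =>
    Measurable.ite (measurableSet_exists_mem hD) (measurable_eval_firstHit hD n)
      measurable_const
  refine measurable_of_tendsto_metrizable hm (tendsto_pi_nhds.2 fun p => ?_)
  refine tendsto_const_nhds.congr' ?_
  by_cases hp : ∃ t, p.1 t ∈ D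
  · filter_upwards [eventually_eval_firstHit_eq hD hp] with m hm
    rw [if_pos hp, hm]
  · filter_upwards with m
    rw [if_neg hp, hitPt_of_forall_notMem (by simpa using hp)]

/-- The positive part of the imaginary part of the path on hitting `D`; zero if `D` is never
hit. -/
noncomputable def imHit (D : Set ℂ) (p : CPath) : ℝ := max 0 (hitPt D p).im

lemma imHit_of_isLeast {p : CPath} {t : ℝ≥0} (ht : IsLeast {t | p.1 t ∈ D} t) :
    imHit D p = max 0 (p.1 t).im := by
  rw [imHit, hitPt_of_isLeast ht]

lemma imHit_of_forall_notMem {p : CPath} (h : ∀ t, p.1 t ∉ D) : imHit D p = 0 := by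
  simp [imHit, hitPt_of_forall_notMem h]

lemma imHit_nonneg (p : CPath) : 0 ≤ imHit D p := le_max_left _ _

lemma imHit_le (hD : IsClosed D) {c : ℝ} (hc : 0 ≤ c) (h : ∀ z ∈ D, z.im ≤ c) (p : CPath) :
    imHit D p ≤ c := by
  by_cases hp : ∃ t, p.1 t ∈ D
  · obtain ⟨t, ht⟩ := exists_isLeast_hit hD hp
    rw [imHit_of_isLeast ht]
    exact max_le hc (h _ ht.1)
  · rw [imHit_of_forall_notMem (by simpa using hp)]
    exact hc

lemma measurable_imHit (hD : IsClosed D) : Measurable (imHit D) :=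
  measurable_const.max (Complex.measurable_im.comp (measurable_hitPt hD))

lemma imHit_translate_shift (hD : IsClosed D) {p : CPath} {t : ℝ≥0}
    (h : ∀ s ≤ t, p.1 s ∉ D) : imHit D (translate (p.1 t) (shift t p)) = imHit D p := by
  have hq : ∀ s, (translate (p.1 t) (shift t p)).1 s = p.1 (t + s) := by
    intro s; simp [translate, shift]
  by_cases hp : ∃ s, p.1 s ∈ D
  · obtain ⟨s, hs⟩ := exists_isLeast_hit hD hp
    have hts : t ≤ s := by
      by_contra! hlt
      exact h s hlt.le hs.1
    have hl : IsLeast {u | (translate (p.1 t) (shift t p)).1 u ∈ D} (s - t) := by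
      refine ⟨?_, fun u hu => ?_⟩
      · rw [Set.mem_ofPred_eq, hq, add_tsub_cancel_of_le hts]
        exact hs.1
      · rw [Set.mem_ofPred_eq, hq] at hu
        exact tsub_le_iff_left.2 (hs.2 hu)
    rw [imHit_of_isLeast hs, imHit_of_isLeast hl, hq, add_tsub_cancel_of_le hts]
  · have hp' : ∀ s, p.1 s ∉ D := by simpa using hp
    rw [imHit_of_forall_notMem hp', imHit_of_forall_notMem fun s => by rw [hq]; exact hp' _]

end CPath

lemma IsHHull.isClosed_union_compl {F : Set ℂ} (hF : IsHHull F) : IsClosed (F ∪ UHᶜ) := by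
  have hU : IsClosed (UHᶜ : Set ℂ) := (isOpen_Ioi.preimage Complex.continuous_im).isClosed_compl
  have : F ∪ UHᶜ = closure F ∪ UHᶜ := by
    conv_lhs => rw [← hF.2.1]
    ext z
    simp only [Set.mem_union, Set.mem_inter_iff, Set.mem_compl_iff]
    tauto
  rw [this]
  exact isClosed_closure.union hU

lemma hitTime_eq_of_isLeast {f : ℝ → ℂ} {A : Set ℂ} {s : ℝ}
    (hs : IsLeast {t : ℝ | 0 ≤ t ∧ f t ∈ A} s) : hitTime f A = ENNReal.ofReal s :=
  IsLeast.csInf_eq ⟨⟨s, hs.1, rfl⟩, by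
    rintro _ ⟨t, ht, rfl⟩
    exact ENNReal.ofReal_le_ofReal (hs.2 ht)⟩

/-- The absorbed functional `imAtHit` is the functional `imHit` for the set `F ∪ UHᶜ`. -/
lemma imAtHit_eq_imHit {F : Set ℂ} (hF : IsHHull F) {f : ℝ → ℂ} {p : CPath}
    (hfp : ∀ t : ℝ≥0, f t = p.1 t) :
    imAtHit f F = imHit (F ∪ UHᶜ) p := by
  have hU : IsClosed (UHᶜ : Set ℂ) := (isOpen_Ioi.preimage Complex.continuous_im).isClosed_compl
  by_cases hp : ∃ t, p.1 t ∈ F ∪ UHᶜ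
  · obtain ⟨s, hs⟩ := exists_isLeast_hit hF.isClosed_union_compl hp
    rw [imHit_of_isLeast hs]
    by_cases hsF : p.1 s ∈ F
    · have hl : IsLeast {t : ℝ | 0 ≤ t ∧ f t ∈ F} s := by
        refine ⟨⟨s.2, by rw [hfp]; exact hsF⟩, fun t ht => ?_⟩
        lift t to ℝ≥0 using ht.1
        have := ht.2
        rw [hfp] at this
        exact_mod_cast hs.2 (Or.inl this)
      have hhit := hitTime_eq_of_isLeast hl
      have hlt : hitTime f F < exitTime f UH := by
        rw [hhit]
        by_cases he : ∃ t, p.1 t ∈ UHᶜ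
        · obtain ⟨u, hu⟩ := exists_isLeast_hit hU he
          have hu' : IsLeast {t : ℝ | 0 ≤ t ∧ f t ∈ UHᶜ} u := by
            refine ⟨⟨u.2, by rw [hfp]; exact hu.1⟩, fun t ht => ?_⟩
            lift t to ℝ≥0 using ht.1
            have := ht.2
            rw [hfp] at this
            exact_mod_cast hu.2 this
          rw [exitTime, hitTime_eq_of_isLeast hu', ENNReal.ofReal_coe_nnreal,
            ENNReal.ofReal_coe_nnreal, ENNReal.coe_lt_coe]
          refine lt_of_le_of_ne (hs.2 (Or.inr hu.1)) ?_
          rintro rfl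
          exact hu.1 (hF.1 hsF)
        · have : {t : ℝ | 0 ≤ t ∧ f t ∈ UHᶜ} = ∅ := by
            refine Set.eq_empty_of_forall_notMem fun t ht => he ?_
            obtain ⟨h1, h2⟩ := ht
            lift t to ℝ≥0 using h1
            exact ⟨t, hfp t ▸ h2⟩
          rw [exitTime, hitTime, this, Set.image_empty, sInf_empty]
          exact ENNReal.ofReal_lt_top
      have hex : ∃ t : ℝ, 0 ≤ t ∧ ENNReal.ofReal t = hitTime f F ∧
          hitTime f F < exitTime f UH := ⟨s, s.2, hhit.symm, hlt⟩
      rw [imAtHit, dif_pos hex]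
      have hc := hex.choose_spec
      have : hex.choose = s := by
        have h1 := hc.2.1.trans hhit
        exact (ENNReal.ofReal_eq_ofReal_iff hc.1 s.2).1 h1
      rw [this, hfp]
      exact (max_eq_right (le_of_lt (hF.1 hsF))).symm
    · have hsU : p.1 s ∈ UHᶜ := hs.1.resolve_left hsF
      have hle : (p.1 s).im ≤ 0 := not_lt.1 hsU
      rw [max_eq_left hle, imAtHit, dif_neg]
      rintro ⟨t, ht, hteq, hlt⟩
      have hsexit : exitTime f UH ≤ ENNReal.ofReal s :=
        csInf_le (OrderBot.bddBelow _) ⟨s, ⟨s.2, by rw [hfp]; exact hsU⟩, rfl⟩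
      have hF' : ENNReal.ofReal s ≤ hitTime f F := by
        refine le_sInf ?_
        rintro _ ⟨u, ⟨hu, huF⟩, rfl⟩
        lift u to ℝ≥0 using hu
        rw [hfp] at huF
        exact ENNReal.ofReal_le_ofReal (by exact_mod_cast hs.2 (Or.inl huF))
      exact absurd (hlt.trans_le (hsexit.trans hF')) (lt_irrefl _)
  · have hp' : ∀ t, p.1 t ∉ F ∪ UHᶜ := by simpa using hp
    rw [imHit_of_forall_notMem hp', imAtHit, dif_neg]
    rintro ⟨t, ht, hteq, hlt⟩
    have : {t : ℝ | 0 ≤ t ∧ f t ∈ F} = ∅ := by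
      refine Set.eq_empty_of_forall_notMem fun t ht => ?_
      obtain ⟨h1, h2⟩ := ht
      lift t to ℝ≥0 using h1
      exact hp' t (Or.inl (hfp t ▸ h2))
    rw [hitTime, this, Set.image_empty, sInf_empty] at hlt
    exact absurd hlt not_top_lt

section CharFun

open scoped FourierTransform

lemma integrable_exp_neg_mul_abs {c : ℝ} (hc : 0 < c) :
    Integrable fun x : ℝ => (Real.exp (-c * |x|) : ℂ) := by
  have h1 : IntegrableOn (fun x : ℝ => (Real.exp (-c * |x|) : ℂ)) (Set.Iic 0) := by
    refine (integrableOn_exp_mul_complex_Iic (a := c) (by simpa using hc) 0).congr_fun ?_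
      measurableSet_Iic
    intro x hx
    simp [abs_of_nonpos (Set.mem_Iic.1 hx)]
  have h2 : IntegrableOn (fun x : ℝ => (Real.exp (-c * |x|) : ℂ)) (Set.Ioi 0) := by
    refine (integrableOn_exp_mul_complex_Ioi (a := -c) (by simpa using hc) 0).congr_fun ?_
      measurableSet_Ioi
    intro x hx
    simp [abs_of_pos (Set.mem_Ioi.1 hx)]
  have := h1.union h2
  rwa [Set.Iic_union_Ioi, integrableOn_univ] at this

lemma fourier_exp_neg_mul_abs {c : ℝ} (hc : 0 < c) (ξ : ℝ) :
    𝓕 (fun x : ℝ => (Real.exp (-c * |x|) : ℂ)) ξ =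
      ((2 * c / (c ^ 2 + (2 * Real.pi * ξ) ^ 2) : ℝ) : ℂ) := by
  rw [Real.fourier_real_eq_integral_exp_smul]
  set w : ℝ := 2 * Real.pi * ξ with hw
  have e1 : Set.EqOn (fun x : ℝ => Complex.exp (↑(-2 * Real.pi * x * ξ) * Complex.I) •
      (Real.exp (-c * |x|) : ℂ)) (fun x => Complex.exp ((c - w * Complex.I) * x))
      (Set.Iic 0) := by
    intro x hx
    simp only [smul_eq_mul, abs_of_nonpos (Set.mem_Iic.1 hx), Complex.ofReal_exp,
      ← Complex.exp_add, hw]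
    congr 1
    push_cast
    ring
  have e2 : Set.EqOn (fun x : ℝ => Complex.exp (↑(-2 * Real.pi * x * ξ) * Complex.I) •
      (Real.exp (-c * |x|) : ℂ)) (fun x => Complex.exp ((-c - w * Complex.I) * x))
      (Set.Ioi 0) := by
    intro x hx
    simp only [smul_eq_mul, abs_of_pos (Set.mem_Ioi.1 hx), Complex.ofReal_exp,
      ← Complex.exp_add, hw]
    congr 1
    push_cast
    ring
  have r1 : 0 < ((c : ℂ) - w * Complex.I).re := by simpa using hc
  have r2 : (-(c : ℂ) - w * Complex.I).re < 0 := by simpa using hc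
  rw [← intervalIntegral.integral_Iic_add_Ioi (b := 0)
    ((integrableOn_exp_mul_complex_Iic r1 0).congr_fun e1.symm measurableSet_Iic)
    ((integrableOn_exp_mul_complex_Ioi r2 0).congr_fun e2.symm measurableSet_Ioi),
    setIntegral_congr_fun measurableSet_Iic e1, setIntegral_congr_fun measurableSet_Ioi e2,
    integral_exp_mul_complex_Iic r1, integral_exp_mul_complex_Ioi r2]
  have n1 : (c : ℂ) - w * Complex.I ≠ 0 := fun h => by simp [h] at r1
  have n2 : -(c : ℂ) - w * Complex.I ≠ 0 := fun h => by simp [h] at r2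
  have n3 : (c : ℂ) ^ 2 + w ^ 2 ≠ 0 := by
    have : c ^ 2 + w ^ 2 ≠ 0 := by positivity
    exact_mod_cast this
  simp only [Complex.ofReal_zero, mul_zero, Complex.exp_zero]
  push_cast
  field_simp
  linear_combination (-2 * (c : ℂ) * w ^ 2) * Complex.I_sq

lemma charFun_cauchyMeasure {d : ℝ≥0} (hd : d ≠ 0) (θ : ℝ) :
    charFun (cauchyMeasure 0 d) θ = Real.exp (-d * |θ|) := by
  have hd' : 0 < (d : ℝ) := by exact_mod_cast pos_iff_ne_zero.2 hd
  have hc : 0 < 2 * Real.pi * (d : ℝ) := by positivity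
  have hF : 𝓕 (fun x : ℝ => (Real.exp (-(2 * Real.pi * d) * |x|) : ℂ)) =
      fun ξ => (cauchyPDFReal 0 d ξ : ℂ) := by
    ext ξ
    rw [fourier_exp_neg_mul_abs hc, cauchyPDFReal_def, sub_zero]
    congr 1
    have : ξ ^ 2 + (d : ℝ) ^ 2 ≠ 0 := by positivity
    field_simp
    ring
  have hinv := Continuous.fourierInv_fourier_eq
    (f := fun x : ℝ => (Real.exp (-(2 * Real.pi * d) * |x|) : ℂ)) (by fun_prop)
    (integrable_exp_neg_mul_abs hc) (by rw [hF]; exact (integrable_cauchyPDFReal 0).ofReal)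
  have h := congrFun hinv (θ / (2 * Real.pi))
  rw [hF, Real.fourierInv_eq'] at h
  rw [charFun_apply_real, cauchyMeasure_of_scale_ne_zero _ hd,
    integral_withDensity_eq_integral_toReal_smul (measurable_cauchyPDF 0 d)
      (by simp [cauchyPDF])]
  have hθ : Real.exp (-(2 * Real.pi * d) * |θ / (2 * Real.pi)|) = Real.exp (-d * |θ|) := by
    rw [abs_div, abs_of_pos (by positivity : 0 < 2 * Real.pi)]
    congr 1
    field_simp
  rw [← hθ, ← h]
  refine integral_congr_ae (Eventually.of_forall fun x => ?_)
  simp only [cauchyPDF, ENNReal.toReal_ofReal (cauchyPDF_pos 0 hd x).le, smul_eq_mul,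
    Complex.real_smul]
  rw [mul_comm]
  congr 2
  simp
  field_simp

end CharFun

/-- The entire function `z ↦ exp (iθz)` is harmonic, hence has mean `1` under centred rotation
invariant Gaussian laws. -/
lemma integral_exp_planarGaussian (v : ℝ≥0) (θ : ℝ) :
    ∫ z, Complex.exp (Complex.I * θ * z) ∂planarGaussian v = 1 := by
  have hm : Measurable fun z : ℂ => Complex.exp (Complex.I * θ * z) := by fun_prop
  rw [planarGaussian, integral_map measurable_equivRealProd_symm.aemeasurable
    hm.aestronglyMeasurable]
  have : ∀ p : ℝ × ℝ, Complex.exp (Complex.I * θ * Complex.equivRealProd.symm p) =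
      Complex.exp (θ * p.1 * Complex.I) * ((Real.exp (-θ * p.2) : ℝ) : ℂ) := by
    intro p
    rw [Complex.ofReal_exp, ← Complex.exp_add, Complex.equivRealProd_symm_apply]
    congr 1
    push_cast
    linear_combination (θ * p.2 : ℂ) * Complex.I_sq
  simp_rw [this]
  rw [integral_prod_mul (fun x : ℝ => Complex.exp (θ * x * Complex.I))
    (fun y : ℝ => ((Real.exp (-θ * y) : ℝ) : ℂ)), ← charFun_apply_real, charFun_gaussianReal,
    integral_complex_ofReal]
  have hmgf := congrFun (mgf_fun_id_gaussianReal (μ := 0) (v := v)) (-θ)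
  rw [mgf] at hmgf
  rw [hmgf, Complex.ofReal_exp, ← Complex.exp_add]
  simp

lemma integrable_exp_planarGaussian (v : ℝ≥0) (θ : ℝ) :
    Integrable (fun z : ℂ => Complex.exp (Complex.I * θ * z)) (planarGaussian v) := by
  by_contra h
  have := integral_exp_planarGaussian v θ
  rw [integral_undef h] at this
  exact zero_ne_one this

/-- The closed half-plane below height `-d`. -/
def lowerHalf (d : ℝ≥0) : Set ℂ := {z | z.im ≤ -d}

lemma isClosed_lowerHalf (d : ℝ≥0) : IsClosed (lowerHalf d) :=
  isClosed_Iic.preimage Complex.continuous_im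

lemma neg_le_im_of_le_firstHit {d N s : ℝ≥0} {p : CPath} (h0 : p.1 0 = 0)
    (hs : s ≤ firstHit (lowerHalf d) N p) : -(d : ℝ) ≤ (p.1 s).im := by
  by_contra! hlt
  have hc : ContinuousOn (fun u => (p.1 u).im) (Set.Icc 0 s) :=
    (Complex.continuous_im.comp p.2).continuousOn
  obtain ⟨u, hu, hu'⟩ := intermediate_value_Icc' (zero_le (a := s)) hc
    (show -(d : ℝ) ∈ Set.Icc _ _ from ⟨hlt.le, by simp [h0]⟩)
  have hus : u < s := lt_of_le_of_ne hu.2 (by rintro rfl; exact hlt.ne hu')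
  have : firstHit (lowerHalf d) N p ≤ u := firstHit_le_of_mem (show _ ≤ _ from hu'.le)
  exact absurd (hs.trans this) (not_le.2 hus)

lemma im_hitPt_lowerHalf {d : ℝ≥0} {p : CPath} (h0 : p.1 0 = 0)
    (hp : ∃ t, p.1 t ∈ lowerHalf d) : (hitPt (lowerHalf d) p).im = -d := by
  obtain ⟨t, ht⟩ := exists_isLeast_hit (isClosed_lowerHalf d) hp
  rw [hitPt_of_isLeast ht]
  exact le_antisymm ht.1 (neg_le_im_of_le_firstHit h0 (firstHit_of_isLeast ht le_rfl).ge)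

namespace IsWiener

variable {μ : Measure CPath}

lemma map_eval (hμ : IsWiener μ) (t : ℝ≥0) :
    μ.map (fun p => p.1 t) = planarGaussian t := by
  have := hμ.prob
  ext B hB
  have h := hμ.incr 0 t zero_le Set.univ MeasurableSet.univ (fun _ _ _ _ => trivial) B hB
  rw [Set.univ_inter, measure_univ, one_mul, tsub_zero] at h
  rw [← h, Measure.map_apply (measurable_eval t) hB]
  refine measure_congr ?_
  filter_upwards [hμ.zero] with p hp
  change (p.1 t ∈ B) = (p.1 t - p.1 0 ∈ B)
  rw [hp, sub_zero]

lemma integral_exp_firstHit (hμ : IsWiener μ) {D : Set ℂ} (hD : IsClosed D) (N : ℝ≥0) (θ : ℝ) :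
    ∫ p, Complex.exp (Complex.I * θ * p.1 (firstHit D N p)) ∂μ = 1 := by
  have := hμ.prob
  have hφ : Measurable fun z : ℂ => Complex.exp (Complex.I * θ * z) := by fun_prop
  have hev : ∀ t, ∫ p : CPath, Complex.exp (Complex.I * θ * p.1 t) ∂μ = 1 := by
    intro t
    rw [← integral_exp_planarGaussian t θ, ← hμ.map_eval t,
      integral_map (measurable_eval t).aemeasurable hφ.aestronglyMeasurable]
  have hinteg : Integrable (fun p : CPath => Complex.exp (Complex.I * θ * p.1 N)) μ := by
    have h := integrable_exp_planarGaussian N θ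
    rw [← hμ.map_eval N] at h
    exact h.comp_measurable (measurable_eval N)
  have hT := measurable_firstHit hD N
  let X : CPath → ℝ≥0 × ℂ := fun p => (firstHit D N p, p.1 (firstHit D N p))
  have hX : Measurable X := hT.prodMk (measurable_eval_firstHit hD N)
  have hlaw := hμ.map_prodMk_shift hT (isStopTime_firstHit hD N) hX fun f g hfg =>
    Prod.ext (isStopTime_firstHit hD N f g hfg) (eval_firstHit_congr hD N hfg)
  have := Measure.isProbabilityMeasure_map (μ := μ) hX.aemeasurable
  let G : (ℝ≥0 × ℂ) × CPath → ℂ := fun a =>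
    Complex.exp (Complex.I * θ * a.1.2) * Complex.exp (Complex.I * θ * a.2.1 (N - a.1.1))
  have hG : Measurable G :=
    (hφ.comp (measurable_snd.comp measurable_fst)).mul (hφ.comp (measurable_eval_comp
      (measurable_const.sub (measurable_fst.comp measurable_fst)) measurable_snd))
  have hXs : Measurable fun p => (X p, shift (firstHit D N p) p) :=
    hX.prodMk (measurable_shift hT)
  have hGX : ∀ p, G (X p, shift (firstHit D N p) p) = Complex.exp (Complex.I * θ * p.1 N) := by
    intro p
    simp only [G, X, shift, ← Complex.exp_add, add_tsub_cancel_of_le (firstHit_le D N p)]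
    congr 1
    ring
  have hGint : Integrable G ((μ.map X).prod μ) := by
    rw [← hlaw, integrable_map_measure hG.aestronglyMeasurable hXs.aemeasurable]
    exact hinteg.congr (Eventually.of_forall fun p => (hGX p).symm)
  have h1 : ∫ a, G a ∂((μ.map X).prod μ) = 1 := by
    rw [← hlaw, integral_map hXs.aemeasurable hG.aestronglyMeasurable]
    simp_rw [hGX]
    exact hev N
  rw [integral_prod _ hGint] at h1
  simp only [G, integral_const_mul, hev, mul_one] at h1
  have hφ₂ : Measurable fun x : ℝ≥0 × ℂ => Complex.exp (Complex.I * θ * x.2) :=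
    hφ.comp measurable_snd
  rwa [integral_map hX.aemeasurable hφ₂.aestronglyMeasurable] at h1

end IsWiener

lemma norm_exp_I_mul (θ : ℝ) (z : ℂ) :
    ‖Complex.exp (Complex.I * θ * z)‖ = Real.exp (-θ * z.im) := by
  rw [Complex.norm_exp]
  simp

open scoped Classical in
/-- The function `exp (-θ y)` cut off below `-d`. -/
noncomputable def cutExp (θ d y : ℝ) : ℝ := if -d ≤ y then Real.exp (-θ * y) else 0

lemma measurable_cutExp (θ d : ℝ) : Measurable (cutExp θ d) :=
  Measurable.ite measurableSet_Ici (by fun_prop) measurable_const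

lemma cutExp_nonneg (θ d y : ℝ) : 0 ≤ cutExp θ d y := by
  unfold cutExp; split_ifs <;> positivity

lemma cutExp_le {θ : ℝ} (hθ : 0 < θ) (d y : ℝ) : cutExp θ d y ≤ Real.exp (θ * d) := by
  unfold cutExp
  split_ifs with h
  · exact Real.exp_le_exp.2 (by nlinarith)
  · positivity

lemma tendsto_integral_cutExp {θ : ℝ} (hθ : 0 < θ) (d : ℝ) :
    Tendsto (fun n : ℕ => ∫ y, cutExp θ d y ∂gaussianReal 0 ((n : ℝ≥0) ^ 2)) atTop (𝓝 0) := by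
  have hn : ∀ n : ℕ, ∫ y, cutExp θ d y ∂gaussianReal 0 ((n : ℝ≥0) ^ 2) =
      ∫ y, cutExp θ d (n * y) ∂gaussianReal 0 1 := by
    intro n
    have h := gaussianReal_map_const_mul (μ := 0) (v := 1) (n : ℝ)
    have hv : NNReal.mk ((n : ℝ) ^ 2) (sq_nonneg _) * 1 = (n : ℝ≥0) ^ 2 := by
      rw [mul_one]
      exact NNReal.eq (by push_cast; rfl)
    rw [mul_zero, hv] at h
    rw [← h, integral_map (by fun_prop) (measurable_cutExp θ d).aestronglyMeasurable]
  simp_rw [hn]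
  have hm : ∀ n : ℕ, Measurable fun y => cutExp θ d (n * y) := fun n =>
    (measurable_cutExp θ d).comp (measurable_const_mul _)
  rw [show 𝓝 (0 : ℝ) = 𝓝 (∫ _y : ℝ, (0 : ℝ) ∂gaussianReal 0 1) by simp]
  refine tendsto_integral_of_dominated_convergence (fun _ => Real.exp (θ * d))
    (fun n => (hm n).aestronglyMeasurable)
    (integrable_const _) (fun n => Eventually.of_forall fun y => ?_) ?_
  · rw [Real.norm_of_nonneg (cutExp_nonneg _ _ _)]
    exact cutExp_le hθ _ _
  · have := nullSingletonClass_gaussianReal (μ := 0) (v := 1) one_ne_zero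
    have h0 : ∀ᵐ y ∂gaussianReal 0 1, y ≠ 0 := Measure.ae_ne _ _
    filter_upwards [h0] with y hy
    rcases lt_or_gt_of_ne hy with hneg | hpos
    · have ht : Tendsto (fun n : ℕ => (n : ℝ) * y) atTop atBot :=
        tendsto_natCast_atTop_atTop.atTop_mul_const_of_neg hneg
      refine tendsto_const_nhds.congr' ?_
      filter_upwards [ht.eventually_lt_atBot (-d)] with n hn
      rw [cutExp, if_neg (not_le.2 hn)]
    · have ht : Tendsto (fun n : ℕ => (n : ℝ) * y) atTop atTop :=
        tendsto_natCast_atTop_atTop.atTop_mul_const hpos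
      have he : Tendsto (fun n : ℕ => Real.exp (-θ * (n * y))) atTop (𝓝 0) :=
        Real.tendsto_exp_atBot.comp (ht.const_mul_atTop_of_neg (neg_lt_zero.2 hθ))
      refine squeeze_zero (fun n => cutExp_nonneg _ _ _) (fun n => ?_) he
      unfold cutExp
      split_ifs
      · exact le_rfl
      · positivity

namespace IsWiener

variable {μ : Measure CPath}

lemma map_im_eval (hμ : IsWiener μ) (t : ℝ≥0) :
    μ.map (fun p => (p.1 t).im) = gaussianReal 0 t := by
  have h1 : μ.map (fun p => (p.1 t).im) = (μ.map fun p => p.1 t).map Complex.im :=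
    (Measure.map_map Complex.measurable_im (measurable_eval t)).symm
  rw [h1, hμ.map_eval, planarGaussian,
    Measure.map_map Complex.measurable_im measurable_equivRealProd_symm]
  have : Complex.im ∘ (fun p : ℝ × ℝ => Complex.equivRealProd.symm p) = Prod.snd := rfl
  rw [this, Measure.map_snd_prod, measure_univ, one_smul]

/-- Planar Brownian motion almost surely hits every lower half-plane. -/
lemma ae_exists_mem_lowerHalf (hμ : IsWiener μ) (d : ℝ≥0) :
    ∀ᵐ p ∂μ, ∃ t, p.1 t ∈ lowerHalf d := by
  have := hμ.prob
  have hL := isClosed_lowerHalf d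
  set A : Set CPath := {p | ∃ t, p.1 t ∈ lowerHalf d} with hA
  have hAm : MeasurableSet A := measurableSet_exists_mem hL
  have key : ∀ θ : ℝ, 0 < θ → 1 ≤ Real.exp (θ * d) * μ.real A := by
    intro θ hθ
    have hcm : ∀ t, Measurable fun p : CPath => cutExp θ d (p.1 t).im := fun t =>
      (measurable_cutExp θ d).comp (Complex.measurable_im.comp (measurable_eval t))
    have hci : ∀ t, Integrable (fun p : CPath => cutExp θ d (p.1 t).im) μ := fun t =>
      Integrable.of_bound (hcm t).aestronglyMeasurable (Real.exp (θ * d))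
        (Eventually.of_forall fun p => by
          rw [Real.norm_of_nonneg (cutExp_nonneg _ _ _)]; exact cutExp_le hθ _ _)
    have hn : ∀ n : ℕ, 1 ≤ Real.exp (θ * d) * μ.real A +
        ∫ y, cutExp θ d y ∂gaussianReal 0 ((n : ℝ≥0) ^ 2) := by
      intro n
      have hIm : Measurable fun p : CPath => (p.1 ((n : ℝ≥0) ^ 2)).im :=
        Complex.measurable_im.comp (measurable_eval _)
      rw [← hμ.map_im_eval, integral_map hIm.aemeasurable
        (measurable_cutExp θ d).aestronglyMeasurable]
      set N : ℝ≥0 := (n : ℝ≥0) ^ 2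
      calc (1 : ℝ) = ‖∫ p, Complex.exp (Complex.I * θ * p.1 (firstHit (lowerHalf d) N p)) ∂μ‖ := by
            rw [hμ.integral_exp_firstHit hL, norm_one]
        _ ≤ ∫ p, ‖Complex.exp (Complex.I * θ * p.1 (firstHit (lowerHalf d) N p))‖ ∂μ :=
            norm_integral_le_integral_norm _
        _ ≤ ∫ p, (A.indicator (fun _ => Real.exp (θ * d)) p + cutExp θ d (p.1 N).im) ∂μ := by
            refine integral_mono_of_nonneg (Eventually.of_forall fun p => norm_nonneg _)
              (((integrable_const _).indicator hAm).add (hci N)) ?_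
            filter_upwards [hμ.zero] with p hp0
            rw [norm_exp_I_mul]
            have him := neg_le_im_of_le_firstHit hp0
              (le_refl (firstHit (lowerHalf d) N p))
            by_cases hpA : p ∈ A
            · rw [Set.indicator_of_mem hpA]
              have : Real.exp (-θ * (p.1 (firstHit (lowerHalf d) N p)).im) ≤
                  Real.exp (θ * d) := Real.exp_le_exp.2 (by nlinarith)
              have := cutExp_nonneg θ d (p.1 N).im
              linarith
            · rw [Set.indicator_of_notMem hpA, zero_add]
              have hN : firstHit (lowerHalf d) N p = N :=
                (firstHit_eq_or_mem hL N p).resolve_right fun h => hpA ⟨_, h⟩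
              rw [hN] at him ⊢
              rw [cutExp, if_pos him]
        _ = Real.exp (θ * d) * μ.real A + ∫ p, cutExp θ d (p.1 N).im ∂μ := by
            rw [integral_add ((integrable_const _).indicator hAm) (hci N),
              integral_indicator_const _ hAm, smul_eq_mul, mul_comm]
    have ht := (tendsto_integral_cutExp hθ d).const_add (Real.exp (θ * d) * μ.real A)
    rw [add_zero] at ht
    exact ge_of_tendsto' ht hn
  have hlim : Tendsto (fun θ : ℝ => Real.exp (θ * d) * μ.real A) (𝓝[>] 0)
      (𝓝 (Real.exp (0 * d) * μ.real A)) :=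
    (Continuous.tendsto (by fun_prop) 0).mono_left nhdsWithin_le_nhds
  have h1 : 1 ≤ μ.real A := by
    have := ge_of_tendsto hlim (eventually_mem_nhdsWithin.mono fun θ hθ => key θ hθ)
    simpa using this
  have h2 : μ A = 1 := by
    refine le_antisymm prob_le_one ?_
    rw [← ENNReal.ofReal_one, ← ofReal_measureReal]
    exact ENNReal.ofReal_le_ofReal h1
  exact (prob_compl_eq_zero_iff hAm).2 h2

/-- The exit law of planar Brownian motion from a half-plane is the Cauchy distribution. -/
lemma map_re_hitPt_lowerHalf (hμ : IsWiener μ) {d : ℝ≥0} (hd : d ≠ 0) :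
    μ.map (fun p => (hitPt (lowerHalf d) p).re) = cauchyMeasure 0 d := by
  have := hμ.prob
  have hL := isClosed_lowerHalf d
  have hE := measurable_hitPt hL
  have hre : Measurable fun p => (hitPt (lowerHalf d) p).re := Complex.measurable_re.comp hE
  have := Measure.isProbabilityMeasure_map (μ := μ) hre.aemeasurable
  have hhit := hμ.ae_exists_mem_lowerHalf d
  have hpos : ∀ θ : ℝ, 0 < θ →
      charFun (μ.map fun p => (hitPt (lowerHalf d) p).re) θ = Real.exp (-d * θ) := by
    intro θ hθ
    have hlim : Tendsto (fun n : ℕ => ∫ p, Complex.exp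
        (Complex.I * θ * p.1 (firstHit (lowerHalf d) n p)) ∂μ) atTop
        (𝓝 (∫ p, Complex.exp (Complex.I * θ * hitPt (lowerHalf d) p) ∂μ)) := by
      refine tendsto_integral_of_dominated_convergence (fun _ => Real.exp (θ * d))
        (fun n => ?_) (integrable_const _) (fun n => ?_) ?_
      · exact (Complex.measurable_exp.comp
          ((measurable_eval_firstHit hL n).const_mul (Complex.I * θ))).aestronglyMeasurable
      · filter_upwards [hμ.zero] with p hp0
        rw [norm_exp_I_mul]
        have := neg_le_im_of_le_firstHit hp0 (le_refl (firstHit (lowerHalf d) n p))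
        exact Real.exp_le_exp.2 (by nlinarith)
      · filter_upwards [hhit] with p hp
        refine tendsto_const_nhds.congr' ?_
        filter_upwards [eventually_eval_firstHit_eq hL hp] with n hn
        rw [hn]
    simp_rw [hμ.integral_exp_firstHit hL] at hlim
    have h1 := tendsto_nhds_unique hlim tendsto_const_nhds
    have hm : Measurable fun x : ℝ => Complex.exp (θ * x * Complex.I) := by fun_prop
    rw [charFun_apply_real, integral_map hre.aemeasurable hm.aestronglyMeasurable]
    have h2 : ∫ p, Complex.exp (Complex.I * θ * hitPt (lowerHalf d) p) ∂μ =
        ∫ p, Complex.exp (θ * (hitPt (lowerHalf d) p).re * Complex.I) *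
          (Real.exp (θ * d) : ℂ) ∂μ := by
      refine integral_congr_ae ?_
      filter_upwards [hμ.zero, hhit] with p hp0 hp
      rw [Complex.ofReal_exp, ← Complex.exp_add]
      congr 1
      have him := im_hitPt_lowerHalf hp0 hp
      conv_lhs => rw [← Complex.re_add_im (hitPt (lowerHalf d) p), him]
      push_cast
      linear_combination (-θ * d : ℂ) * Complex.I_sq
    rw [h2, integral_mul_const] at h1
    rw [show -(d : ℝ) * θ = -(θ * d) by ring, Real.exp_neg, Complex.ofReal_inv]
    exact eq_inv_of_mul_eq_one_left h1
  refine Measure.ext_of_charFun (funext fun θ => ?_)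
  rw [charFun_cauchyMeasure hd]
  rcases lt_trichotomy θ 0 with h | rfl | h
  · have h' := hpos (-θ) (neg_pos.2 h)
    rw [charFun_neg] at h'
    rw [abs_of_neg h, ← Complex.conj_conj (charFun _ θ), h', Complex.conj_ofReal]
  · simp
  · rw [hpos θ h, abs_of_pos h]

end IsWiener

/-- The expected value of `imHit D` for the Brownian path started at `z`. -/
noncomputable def meanIm (μ : Measure CPath) (D : Set ℂ) (z : ℂ) : ℝ :=
  ∫ p, imHit D (translate z p) ∂μ

lemma meanIm_nonneg (μ : Measure CPath) (D : Set ℂ) (z : ℂ) : 0 ≤ meanIm μ D z :=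
  integral_nonneg fun _ => imHit_nonneg _

lemma measurable_meanIm (μ : Measure CPath) [SFinite μ] {D : Set ℂ} (hD : IsClosed D) :
    Measurable (meanIm μ D) :=
  ((measurable_imHit hD).comp measurable_translate).stronglyMeasurable.integral_prod_right'
    |>.measurable

namespace IsWiener

variable {μ : Measure CPath} {D : Set ℂ} {c η : ℝ}

lemma norm_meanIm_le (hμ : IsWiener μ) (hD : IsClosed D) (hc : 0 ≤ c)
    (hDc : ∀ z ∈ D, z.im ≤ c) (z : ℂ) : ‖meanIm μ D z‖ ≤ c := by
  have := hμ.prob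
  have h := norm_integral_le_of_norm_le_const (μ := μ) (f := fun p => imHit D (translate z p))
    (C := c) (Eventually.of_forall fun p => by
      rw [Real.norm_of_nonneg (imHit_nonneg _)]; exact imHit_le hD hc hDc _)
  simpa [meanIm] using h

lemma meanIm_eq_integral_firstHit (hμ : IsWiener μ) (hD : IsClosed D) (hc : 0 ≤ c)
    (hDc : ∀ z ∈ D, z.im ≤ c) {d : ℝ≥0} {z : ℂ} (hz : c < z.im - d) (N : ℝ≥0) :
    meanIm μ D z = ∫ p, meanIm μ D (z + p.1 (firstHit (lowerHalf d) N p)) ∂μ := by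
  have := hμ.prob
  have hL := isClosed_lowerHalf d
  have hX := measurable_eval_firstHit hL N
  have hlaw := hμ.map_prodMk_shift (measurable_firstHit hL N) (isStopTime_firstHit hL N) hX
    fun f g hfg => eval_firstHit_congr hL N hfg
  have := Measure.isProbabilityMeasure_map (μ := μ) hX.aemeasurable
  let G : ℂ × CPath → ℝ := fun a => imHit D (translate (z + a.1) a.2)
  have hG : Measurable G := (measurable_imHit hD).comp
    (measurable_translate.comp ((measurable_fst.const_add z).prodMk measurable_snd))
  have hXs := hX.prodMk (measurable_shift (measurable_firstHit hL N))
  have hGint : Integrable G ((μ.map fun p => p.1 (firstHit (lowerHalf d) N p)).prod μ) :=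
    Integrable.of_bound hG.aestronglyMeasurable c (Eventually.of_forall fun a => by
      rw [Real.norm_of_nonneg (imHit_nonneg _)]; exact imHit_le hD hc hDc _)
  have h1 : meanIm μ D z =
      ∫ p, G (p.1 (firstHit (lowerHalf d) N p), shift (firstHit (lowerHalf d) N p) p) ∂μ := by
    refine integral_congr_ae ?_
    filter_upwards [hμ.zero] with p hp0
    have havoid : ∀ s ≤ firstHit (lowerHalf d) N p, (translate z p).1 s ∉ D := by
      intro s hs hmem
      have h1 := hDc _ hmem
      have h2 := neg_le_im_of_le_firstHit hp0 hs
      simp only [CPath.translate, Complex.add_im] at h1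
      linarith
    rw [← imHit_translate_shift hD havoid]
    simp only [G]
    congr 2
    exact Subtype.ext (funext fun s => by simp [shift, CPath.translate])
  rw [h1, ← integral_map hXs.aemeasurable hG.aestronglyMeasurable, hlaw, integral_prod _ hGint]
  have hm : Measurable fun w => meanIm μ D (z + w) :=
    (measurable_meanIm μ hD).comp (measurable_const_add z)
  exact integral_map hX.aemeasurable hm.aestronglyMeasurable

/-- The Poisson integral formula for the mean imaginary part on hitting `D`. -/
lemma meanIm_eq_integral_cauchyMeasure (hμ : IsWiener μ) (hD : IsClosed D) (hc : 0 ≤ c)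
    (hDc : ∀ z ∈ D, z.im ≤ c) (hη : c < η) {d : ℝ≥0} (hd : d ≠ 0) :
    meanIm μ D (((η + d : ℝ) : ℂ) * Complex.I) =
      ∫ x : ℝ, meanIm μ D (x + η * Complex.I) ∂cauchyMeasure 0 d := by
  have := hμ.prob
  have hL := isClosed_lowerHalf d
  set z : ℂ := ((η + d : ℝ) : ℂ) * Complex.I with hz
  have hzim : c < z.im - d := by simp [hz, hη]
  have hm : Measurable fun w => meanIm μ D (z + w) :=
    (measurable_meanIm μ hD).comp (measurable_const_add z)
  have hlim : Tendsto (fun n : ℕ => ∫ p, meanIm μ D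
      (z + p.1 (firstHit (lowerHalf d) n p)) ∂μ) atTop
      (𝓝 (∫ p, meanIm μ D (z + hitPt (lowerHalf d) p) ∂μ)) := by
    refine tendsto_integral_of_dominated_convergence (fun _ => c)
      (fun n => (hm.comp (measurable_eval_firstHit hL n)).aestronglyMeasurable)
      (integrable_const _)
      (fun n => Eventually.of_forall fun p => hμ.norm_meanIm_le hD hc hDc _) ?_
    filter_upwards [hμ.ae_exists_mem_lowerHalf d] with p hp
    refine tendsto_const_nhds.congr' ?_
    filter_upwards [eventually_eval_firstHit_eq hL hp] with n hn
    rw [hn]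
  simp_rw [← hμ.meanIm_eq_integral_firstHit hD hc hDc hzim] at hlim
  have hre : Measurable fun p => (hitPt (lowerHalf d) p).re :=
    Complex.measurable_re.comp (measurable_hitPt hL)
  have hH : Measurable fun x : ℝ => meanIm μ D (x + η * Complex.I) :=
    (measurable_meanIm μ hD).comp (by fun_prop)
  rw [tendsto_nhds_unique tendsto_const_nhds hlim, ← hμ.map_re_hitPt_lowerHalf hd,
    integral_map hre.aemeasurable hH.aestronglyMeasurable]
  refine integral_congr_ae ?_
  filter_upwards [hμ.zero, hμ.ae_exists_mem_lowerHalf d] with p hp0 hp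
  congr 1
  apply Complex.ext <;> simp [hz, im_hitPt_lowerHalf hp0 hp]

/-- If `y E_{iy}` tends to `a` then the horizontal integral of the mean imaginary part is
`π a`. -/
lemma integral_meanIm_eq (hμ : IsWiener μ) (hD : IsClosed D) (hc : 0 ≤ c)
    (hDc : ∀ z ∈ D, z.im ≤ c) (hη : c < η) {a : ℝ}
    (ha : Tendsto (fun y : ℝ => y * meanIm μ D ((y : ℂ) * Complex.I)) atTop (𝓝 a)) :
    ∫ x : ℝ, meanIm μ D (x + η * Complex.I) = Real.pi * a := by
  have := hμ.prob
  have hη0 : 0 < η := hc.trans_lt hη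
  set H : ℝ → ℝ := fun x => meanIm μ D (x + η * Complex.I) with hH
  have hHm : Measurable H := (measurable_meanIm μ hD).comp (by fun_prop)
  have hH0 : ∀ x, 0 ≤ H x := fun x => meanIm_nonneg _ _ _
  have ha0 : 0 ≤ a := ge_of_tendsto ha ((eventually_ge_atTop 0).mono fun y hy =>
    mul_nonneg hy (meanIm_nonneg _ _ _))
  let K : ℕ → ℝ → ℝ := fun n x => H x * (((n : ℝ) + 1) ^ 2 / (x ^ 2 + ((n : ℝ) + 1) ^ 2))
  have hKm : ∀ n, Measurable (K n) := fun n => hHm.mul (by fun_prop)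
  have hK0 : ∀ n x, 0 ≤ K n x := fun n x => mul_nonneg (hH0 x) (by positivity)
  have hKint : ∀ n : ℕ, ∫⁻ x, ENNReal.ofReal (K n x) = ENNReal.ofReal
      (Real.pi * (((n : ℝ) + 1) * meanIm μ D (((η + (n + 1) : ℝ) : ℂ) * Complex.I))) := by
    intro n
    let d : ℝ≥0 := n + 1
    have hd : d ≠ 0 := by positivity
    have hdn : (d : ℝ) = n + 1 := by simp [d]
    have hp : _ = ∫ x, H x ∂cauchyMeasure 0 d :=
      hμ.meanIm_eq_integral_cauchyMeasure hD hc hDc hη hd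
    rw [hdn] at hp
    rw [cauchyMeasure_of_scale_ne_zero _ hd,
      integral_withDensity_eq_integral_toReal_smul (measurable_cauchyPDF 0 d)
        (by simp [cauchyPDF])] at hp
    have hfun : ∀ x, (cauchyPDF 0 d x).toReal • H x = (Real.pi * (n + 1))⁻¹ * K n x := by
      intro x
      have : x ^ 2 + ((n : ℝ) + 1) ^ 2 ≠ 0 := by positivity
      rw [cauchyPDF, ENNReal.toReal_ofReal (cauchyPDF_pos 0 hd x).le, cauchyPDFReal_def, hdn,
        smul_eq_mul, sub_zero]
      simp only [K]
      field_simp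
    have hinteg : Integrable (fun x => (cauchyPDF 0 d x).toReal • H x) := by
      have hb : Integrable fun x => c * cauchyPDFReal 0 d x :=
        (integrable_cauchyPDFReal 0).const_mul c
      refine hb.mono ((measurable_cauchyPDF 0 d).ennreal_toReal.smul hHm).aestronglyMeasurable
        (Eventually.of_forall fun x => ?_)
      have hpos := (cauchyPDF_pos 0 hd x).le
      rw [cauchyPDF, ENNReal.toReal_ofReal hpos, norm_smul, norm_mul, Real.norm_of_nonneg hpos,
        Real.norm_of_nonneg hc, mul_comm]
      exact mul_le_mul_of_nonneg_right (hμ.norm_meanIm_le hD hc hDc _) hpos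
    have hKi : Integrable (K n) := by
      refine (hinteg.const_mul (Real.pi * (n + 1))).congr (Eventually.of_forall fun x => ?_)
      have : (0 : ℝ) < n + 1 := by positivity
      simp only [hfun]
      field_simp
    rw [integral_congr_ae (Eventually.of_forall hfun), integral_const_mul] at hp
    rw [← ofReal_integral_eq_lintegral_ofReal hKi (Eventually.of_forall (hK0 n)), hp]
    congr 1
    have : (0 : ℝ) < n + 1 := by positivity
    field_simp
  have hlim1 : Tendsto (fun n : ℕ => ∫⁻ x, ENNReal.ofReal (K n x)) atTop
      (𝓝 (∫⁻ x, ENNReal.ofReal (H x))) := by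
    refine lintegral_tendsto_of_tendsto_of_monotone
      (fun n => (hKm n).ennreal_ofReal.aemeasurable) (Eventually.of_forall fun x => ?_)
      (Eventually.of_forall fun x => ?_)
    · intro m n hmn
      refine ENNReal.ofReal_le_ofReal (mul_le_mul_of_nonneg_left ?_ (hH0 x))
      have h1 : (m : ℝ) + 1 ≤ n + 1 := by exact_mod_cast Nat.succ_le_succ hmn
      have h2 : ((m : ℝ) + 1) ^ 2 ≤ ((n : ℝ) + 1) ^ 2 := by gcongr
      rw [div_le_div_iff₀ (by positivity) (by positivity)]
      nlinarith [mul_le_mul_of_nonneg_right h2 (sq_nonneg x)]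
    · refine ENNReal.tendsto_ofReal ?_
      have hn : Tendsto (fun n : ℕ => ((n : ℝ) + 1) ^ 2) atTop atTop :=
        (tendsto_pow_atTop two_ne_zero).comp
          (tendsto_atTop_add_const_right _ _ tendsto_natCast_atTop_atTop)
      have h1 : Tendsto (fun n : ℕ => 1 - x ^ 2 / (x ^ 2 + ((n : ℝ) + 1) ^ 2)) atTop
          (𝓝 (1 - 0)) :=
        tendsto_const_nhds.sub (tendsto_const_nhds.div_atTop
          (tendsto_atTop_add_const_left _ _ hn))
      have h2 := h1.const_mul (H x)
      rw [sub_zero, mul_one] at h2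
      refine h2.congr fun n => ?_
      simp only [K]
      congr 1
      have : x ^ 2 + ((n : ℝ) + 1) ^ 2 ≠ 0 := by positivity
      field_simp
      ring
  have hlim2 : Tendsto (fun n : ℕ => ∫⁻ x, ENNReal.ofReal (K n x)) atTop
      (𝓝 (ENNReal.ofReal (Real.pi * a))) := by
    simp_rw [hKint]
    refine ENNReal.tendsto_ofReal (Tendsto.const_mul _ ?_)
    have hn : Tendsto (fun n : ℕ => η + ((n : ℝ) + 1)) atTop atTop :=
      tendsto_atTop_add_const_left _ _
        (tendsto_atTop_add_const_right _ _ tendsto_natCast_atTop_atTop)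
    have h1 : Tendsto (fun n : ℕ => 1 - η / (η + ((n : ℝ) + 1))) atTop (𝓝 (1 - 0)) :=
      tendsto_const_nhds.sub (tendsto_const_nhds.div_atTop hn)
    have h2 := h1.mul (ha.comp hn)
    rw [sub_zero, one_mul] at h2
    refine h2.congr fun n => ?_
    have : η + ((n : ℝ) + 1) ≠ 0 := by positivity
    simp only [Function.comp_apply]
    field_simp
    ring
  rw [integral_eq_lintegral_of_nonneg_ae (Eventually.of_forall hH0) hHm.aestronglyMeasurable,
    tendsto_nhds_unique hlim1 hlim2, ENNReal.toReal_ofReal (by positivity)]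

end IsWiener

lemma PlanarBM.integral_imAtHit {Ω : Type*} [MeasurableSpace Ω] (BM : PlanarBM Ω) {F : Set ℂ}
    (hF : IsHHull F) {μ : Measure CPath} (hμ : IsWiener μ) (w : ℂ) :
    ∫ ω, imAtHit (fun t => BM.Z t ω) F ∂BM.P w = meanIm μ (F ∪ UHᶜ) w := by
  rw [hμ.unique (BM.isWiener_map_path w), meanIm]
  have hm : Measurable fun p : CPath => imHit (F ∪ UHᶜ) (translate w p) :=
    (measurable_imHit hF.isClosed_union_compl).comp
      (measurable_translate.comp (measurable_const.prodMk measurable_id))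
  rw [integral_map (BM.measurable_path w).aemeasurable hm.aestronglyMeasurable]
  refine integral_congr_ae ?_
  filter_upwards [BM.ae_mem_continuitySet w] with ω hω
  refine imAtHit_eq_imHit hF fun t => ?_
  simp [CPath.translate, BM.path_apply hω]

/-- Expression of half-plane capacity: for an ℍ-hull `F` with bounded imaginary
part and finite half-plane capacity `a`, for any `η > Im F`,
`hcap F = (1/π) ∫_ℝ E_{ξ+iη}[Im Z_{σ_F}] dξ`. -/
theorem hcap_integral_formula {Ω : Type*} [MeasurableSpace Ω] (BM : PlanarBM Ω)
    (F : Set ℂ) (a : ℝ)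
    (hF : IsHHull F) (hIm : BddAbove (Complex.im '' F))
    (hcap : HasHcap BM F a)
    (η : ℝ) (hη : sSup (Complex.im '' F) < η) :
    a = Real.pi⁻¹ *
      ∫ ξ : ℝ, ∫ ω, imAtHit (fun t => BM.Z t ω) F ∂BM.P ((ξ : ℂ) + (η : ℂ) * Complex.I) := by
  have hμ := BM.isWiener_map_path 0
  have hD := hF.isClosed_union_compl
  have hc : ∀ z ∈ F ∪ UHᶜ, z.im ≤ max 0 (sSup (Complex.im '' F)) := by
    rintro z (hz | hz)
    · exact le_max_of_le_right (le_csSup hIm ⟨z, hz, rfl⟩)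
    · exact le_max_of_le_left (not_lt.1 hz)
  have hη0 : 0 < η := by
    refine lt_of_le_of_lt (Real.sSup_nonneg ?_) hη
    rintro _ ⟨z, hz, rfl⟩
    exact le_of_lt (hF.1 hz)
  simp only [HasHcap, BM.integral_imAtHit hF hμ] at hcap ⊢
  rw [hμ.integral_meanIm_eq hD (le_max_left _ _) hc (max_lt hη0 hη) hcap,
    inv_mul_cancel_left₀ Real.pi_ne_zero]
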